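/- (Example 3.12; sharpness of the component bound.) Let p be a prime number and assume in addition that ‖(p : L)‖ < 1 (so the residue field k has characteristic p). Let φ(X) = X^p. Then the fixed point locus of φ in A¹_an is exactly Fix(φ) = {ζ_G} ∪ {ev_a : a ∈ L, a^p = a}; it is a finite set with exactly p + 1 elements, each of which is its own connected component, so Fix(φ) has exactly p + 1 = d + 1 connected components (where d = p = deg φ). -/

import Mathlib

open Polynomial

/-- A point of the Berkovich affine line `A¹_an` over `L`: a multiplicative ring seminorm
on `L[X]` whose restriction to the constant polynomials is the given absolute value of `L`. -/
structure BerkovichPoint (L : Type*) [NontriviallyNormedField L] where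
  toFun : Polynomial L → ℝ
  nonneg' : ∀ P, 0 ≤ toFun P
  map_mul' : ∀ P Q, toFun (P * Q) = toFun P * toFun Q
  add_le' : ∀ P Q, toFun (P + Q) ≤ toFun P + toFun Q
  const' : ∀ a : L, toFun (C a) = ‖a‖

namespace BerkovichPoint

variable {L : Type*} [NontriviallyNormedField L]

/-- The topology of pointwise convergence on the Berkovich affine line. -/
instance : TopologicalSpace (BerkovichPoint L) :=
  TopologicalSpace.induced (fun x => x.toFun) Pi.topologicalSpace

/-- The Gauss norm of a polynomial: the maximum of the absolute values of its coefficients.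
The Gauss point `ζ_G` is the point of the Berkovich affine line given by this seminorm. -/
noncomputable def gaussNorm (P : Polynomial L) : ℝ := ⨆ i : ℕ, ‖P.coeff i‖

/-- The type 1 (evaluation) point of the Berkovich affine line attached to `a ∈ L`:
`ev_a(P) = ‖P(a)‖`. -/
noncomputable def evPoint (a : L) : BerkovichPoint L where
  toFun P := ‖P.eval a‖
  nonneg' P := norm_nonneg _
  map_mul' P Q := by simp
  add_le' P Q := by simp only [eval_add]; exact norm_add_le _ _
  const' b := by simp

/-- The action of a polynomial `φ` on the Berkovich affine line by pushforward:
`(φ_* x)(P) = x(P ∘ φ)`.  The fixed point locus of `φ` is `{x | pushforward φ x = x}`. -/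
noncomputable def pushforward (φ : Polynomial L) (x : BerkovichPoint L) : BerkovichPoint L where
  toFun P := x.toFun (P.comp φ)
  nonneg' P := x.nonneg' _
  map_mul' P Q := by simp only [mul_comp]; exact x.map_mul' _ _
  add_le' P Q := by simp only [add_comp]; exact x.add_le' _ _
  const' a := by simp only [C_comp]; exact x.const' a

end BerkovichPoint

open BerkovichPoint

namespace BerkovichPoint

open Filter Topology

variable {L : Type*} [NontriviallyNormedField L]

theorem toFun_injective : Function.Injective (toFun : BerkovichPoint L → L[X] → ℝ) := by
  rintro ⟨f, _, _, _, _⟩ ⟨g, _, _, _, _⟩ h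
  cases h
  rfl

instance : T2Space (BerkovichPoint L) :=
  T2Space.of_injective_continuous toFun_injective continuous_induced_dom

section Seminorm

variable (x : BerkovichPoint L)

theorem map_zero : x.toFun 0 = 0 := by
  simpa using x.const' 0

theorem map_one : x.toFun 1 = 1 := by
  simpa using x.const' 1

theorem map_natCast (n : ℕ) : x.toFun (n : L[X]) = ‖(n : L)‖ := by
  simpa using x.const' (n : L)

theorem map_neg (P : L[X]) : x.toFun (-P) = x.toFun P := by
  have h : -P = C (-1) * P := by simp
  rw [h, x.map_mul', x.const', norm_neg, norm_one, one_mul]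

theorem map_pow (P : L[X]) (n : ℕ) : x.toFun (P ^ n) = x.toFun P ^ n := by
  induction n with
  | zero => simpa using x.map_one
  | succ n ih => rw [pow_succ, x.map_mul', ih, pow_succ]

theorem map_sub_rev (P Q : L[X]) : x.toFun (P - Q) = x.toFun (Q - P) := by
  rw [← x.map_neg, neg_sub]

theorem map_sum_le {ι : Type*} (s : Finset ι) (f : ι → L[X]) :
    x.toFun (∑ i ∈ s, f i) ≤ ∑ i ∈ s, x.toFun (f i) :=
  Finset.le_sum_of_subadditive _ x.map_zero.le x.add_le' s f

theorem map_multiset_prod (s : Multiset L[X]) : x.toFun s.prod = (s.map x.toFun).prod := by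
  induction s using Multiset.induction_on with
  | empty => simpa using x.map_one
  | cons a s ih => simp [x.map_mul', ih]

end Seminorm

theorem le_of_forall_pow_le_succ_mul_pow {A M : ℝ} (hM : 0 ≤ M)
    (h : ∀ n : ℕ, A ^ n ≤ (n + 1) * M ^ n) : A ≤ M := by
  by_contra! hlt
  rcases hM.eq_or_lt with rfl | hM
  · have := h 1
    norm_num at this
    linarith
  have hr : 1 < A / M := (one_lt_div hM).2 hlt
  have ht := tendsto_pow_const_div_const_pow_of_one_lt 1 hr
  obtain ⟨n, hn, hn1⟩ :=
    ((ht.eventually (gt_mem_nhds (show (0 : ℝ) < 1 / 2 by norm_num))).and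
      (eventually_ge_atTop 1)).exists
  have hpos : 0 < (A / M) ^ n := by positivity
  have hle : (A / M) ^ n ≤ n + 1 := by
    rw [div_pow, div_le_iff₀ (by positivity)]
    exact h n
  rw [div_lt_iff₀ hpos, pow_one] at hn
  have : (1 : ℝ) ≤ n := by exact_mod_cast hn1
  linarith

/-- Points of the Berkovich line over a nonarchimedean field are nonarchimedean seminorms. -/
theorem add_le_max (hna : IsNonarchimedean (fun x : L => ‖x‖)) (x : BerkovichPoint L)
    (P Q : L[X]) : x.toFun (P + Q) ≤ max (x.toFun P) (x.toFun Q) := by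
  have hu : IsUltrametricDist L := IsUltrametricDist.isUltrametricDist_of_isNonarchimedean_norm hna
  have hP := x.nonneg' P
  have hQ := x.nonneg' Q
  refine le_of_forall_pow_le_succ_mul_pow (hP.trans (le_max_left _ _)) fun n => ?_
  rw [← x.map_pow, add_pow]
  refine (x.map_sum_le _ _).trans ?_
  have : ∀ m ∈ Finset.range (n + 1), x.toFun (P ^ m * Q ^ (n - m) * (n.choose m : L[X])) ≤
      max (x.toFun P) (x.toFun Q) ^ n := by
    intro m hm
    have hmn : m ≤ n := Nat.lt_succ_iff.1 (Finset.mem_range.1 hm)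
    rw [x.map_mul', x.map_mul', x.map_pow, x.map_pow, x.map_natCast]
    calc _ ≤ x.toFun P ^ m * x.toFun Q ^ (n - m) :=
          mul_le_of_le_one_right (by positivity) (IsUltrametricDist.norm_natCast_le_one L _)
      _ ≤ max (x.toFun P) (x.toFun Q) ^ m * max (x.toFun P) (x.toFun Q) ^ (n - m) := by
          gcongr
          · exact le_max_left _ _
          · exact le_max_right _ _
      _ = _ := by rw [← pow_add, Nat.add_sub_cancel' hmn]
  simpa using Finset.sum_le_sum this

theorem sub_le_max (hna : IsNonarchimedean (fun x : L => ‖x‖)) (x : BerkovichPoint L)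
    (P Q : L[X]) : x.toFun (P - Q) ≤ max (x.toFun P) (x.toFun Q) := by
  simpa [sub_eq_add_neg, x.map_neg] using add_le_max hna x P (-Q)

/-- The polynomials on which a nonarchimedean seminorm is at most `1`. -/
def unitSubring (hna : IsNonarchimedean (fun x : L => ‖x‖)) (x : BerkovichPoint L) :
    Subring L[X] where
  carrier := {P | x.toFun P ≤ 1}
  mul_mem' {P Q} hP hQ := by
    simpa [x.map_mul'] using mul_le_one₀ hP (x.nonneg' Q) hQ
  one_mem' := x.map_one.le
  add_mem' {P Q} hP hQ := (add_le_max hna x P Q).trans (max_le hP hQ)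
  zero_mem' := by simp [x.map_zero]
  neg_mem' {P} hP := by simpa [x.map_neg] using hP

theorem toFun_pow_sub_le (hna : IsNonarchimedean (fun x : L => ‖x‖)) (x : BerkovichPoint L)
    {p : ℕ} (hp : p.Prime) {P Q : L[X]} (hQ : x.toFun Q ≤ 1) (hPQ : x.toFun (P - Q) ≤ 1) :
    x.toFun (P ^ p - Q ^ p) ≤ x.toFun (P - Q) * max (x.toFun (P - Q)) ‖(p : L)‖ := by
  obtain ⟨⟨r, hr⟩, h⟩ := exists_add_pow_prime_eq hp
    (⟨P - Q, hPQ⟩ : unitSubring hna x) (⟨Q, hQ⟩ : unitSubring hna x)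
  have h' := congrArg Subtype.val h
  simp only [Subring.coe_add, Subring.coe_pow, Subring.coe_mul, Subring.coe_natCast,
    sub_add_cancel] at h'
  have hr : x.toFun r ≤ 1 := hr
  have hfac : P ^ p - Q ^ p = (P - Q) * ((P - Q) ^ (p - 1) + p * (Q * r)) := by
    have hpow : (P - Q) ^ p = (P - Q) * (P - Q) ^ (p - 1) := by
      rw [← pow_succ', Nat.sub_add_cancel hp.one_le]
    rw [h', hpow]
    ring
  rw [hfac, x.map_mul']
  refine mul_le_mul_of_nonneg_left ((add_le_max hna x _ _).trans (max_le_max ?_ ?_)) (x.nonneg' _)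
  · rw [x.map_pow]
    exact pow_le_of_le_one (x.nonneg' _) hPQ (Nat.sub_ne_zero_of_lt hp.one_lt)
  · rw [x.map_mul', x.map_mul', x.map_natCast]
    exact mul_le_of_le_one_right (norm_nonneg _) (mul_le_one₀ hQ (x.nonneg' _) hr)

/-- A seminorm vanishing at `X - a` is the evaluation point at `a`. -/
theorem eq_evPoint_of_toFun_X_sub_C_eq_zero (x : BerkovichPoint L) {a : L}
    (h : x.toFun (X - C a) = 0) : x = evPoint a := by
  refine toFun_injective (funext fun P => ?_)
  have hz : x.toFun (P - C (P.eval a)) = 0 := by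
    obtain ⟨Q, hQ⟩ := X_sub_C_dvd_sub_C_eval (a := a) (p := P)
    rw [hQ, x.map_mul', h, zero_mul]
  have h1 := x.add_le' (P - C (P.eval a)) (C (P.eval a))
  have h2 := x.add_le' (C (P.eval a) - P) P
  rw [x.map_sub_rev] at h2
  rw [sub_add_cancel, hz, x.const', zero_add] at h1 h2
  exact le_antisymm h1 h2

/-- Over an algebraically closed field a seminorm is determined by its values at the
polynomials `X - a`. -/
theorem ext_X_sub_C [IsAlgClosed L] {x y : BerkovichPoint L}
    (h : ∀ a, x.toFun (X - C a) = y.toFun (X - C a)) : x = y := by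
  refine toFun_injective (funext fun P => ?_)
  rw [(IsAlgClosed.splits P).eq_prod_roots]
  simp only [map_mul', const', map_multiset_prod, Multiset.map_map, Function.comp_def, h]

theorem bddAbove_range_norm_coeff (P : L[X]) : BddAbove (Set.range fun i => ‖P.coeff i‖) := by
  refine ⟨∑ i ∈ P.support, ‖P.coeff i‖, ?_⟩
  rintro _ ⟨i, rfl⟩
  by_cases hi : i ∈ P.support
  · exact Finset.single_le_sum (f := fun i => ‖P.coeff i‖) (fun _ _ => norm_nonneg _) hi
  · simpa [notMem_support_iff.1 hi] using Finset.sum_nonneg fun i _ => norm_nonneg (P.coeff i)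

theorem norm_coeff_le_gaussNorm (P : L[X]) (i : ℕ) : ‖P.coeff i‖ ≤ gaussNorm P :=
  le_ciSup (bddAbove_range_norm_coeff P) i

theorem gaussNorm_expand {n : ℕ} (hn : 0 < n) (P : L[X]) :
    gaussNorm (expand L n P) = gaussNorm P := by
  refine le_antisymm (ciSup_le fun i => ?_) (ciSup_le fun i => ?_)
  · rw [coeff_expand hn]
    split_ifs
    · exact norm_coeff_le_gaussNorm P _
    · simpa using (norm_nonneg _).trans (norm_coeff_le_gaussNorm P 0)
  · simpa [coeff_expand_mul hn] using norm_coeff_le_gaussNorm (expand L n P) (i * n)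

theorem gaussNorm_X_sub_C (a : L) : gaussNorm (X - C a) = max 1 ‖a‖ := by
  refine le_antisymm (ciSup_le fun i => ?_) (max_le ?_ ?_)
  · rcases i with _ | _ | i
    · simp
    · simp
    · simp [coeff_X]
  · have h := norm_coeff_le_gaussNorm (X - C a : L[X]) 1
    simpa [coeff_sub, coeff_C] using h
  · have h := norm_coeff_le_gaussNorm (X - C a : L[X]) 0
    simpa [coeff_sub] using h

theorem evPoint_injective : Function.Injective (evPoint : L → BerkovichPoint L) := by
  intro a b h
  have : ‖(X - C b : L[X]).eval a‖ = ‖(X - C b : L[X]).eval b‖ :=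
    congrArg (fun x : BerkovichPoint L => x.toFun (X - C b)) h
  simpa [sub_eq_zero] using this

theorem evPoint_ne_gauss {ζ : BerkovichPoint L} (hζ : ∀ P, ζ.toFun P = gaussNorm P) (a : L) :
    evPoint a ≠ ζ := by
  rintro rfl
  have h := hζ (X - C a)
  rw [gaussNorm_X_sub_C] at h
  have h0 : (evPoint a).toFun (X - C a) = 0 := by simp [evPoint]
  linarith [le_max_left 1 ‖a‖]

theorem pushforward_evPoint (φ : L[X]) (a : L) :
    pushforward φ (evPoint a) = evPoint (φ.eval a) :=
  toFun_injective (funext fun P => by simp [pushforward, evPoint, eval_comp])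

section PowerMap

variable {p : ℕ} {x : BerkovichPoint L}

theorem toFun_X_pow_sub_C_of_fixed (hx : pushforward (X ^ p) x = x) (a : L) :
    x.toFun (X ^ p - C a) = x.toFun (X - C a) := by
  have h : x.toFun ((X - C a).comp (X ^ p)) = x.toFun (X - C a) :=
    congrArg (fun y : BerkovichPoint L => y.toFun (X - C a)) hx
  rwa [sub_comp, X_comp, C_comp] at h

theorem toFun_X_le_one_of_fixed (hp : 1 < p) (hx : pushforward (X ^ p) x = x) :
    x.toFun X ≤ 1 := by
  have h := toFun_X_pow_sub_C_of_fixed hx 0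
  rw [C_0, sub_zero, sub_zero, x.map_pow] at h
  by_contra! hlt
  linarith [lt_self_pow₀ hlt hp]

/-- A fixed point of `X ^ p` lying in an open unit disc around an integral point is the
evaluation point at the limit of the sequence `a ^ (p ^ n)`. -/
theorem exists_eq_evPoint_of_fixed [CompleteSpace L]
    (hna : IsNonarchimedean (fun x : L => ‖x‖)) (hp : p.Prime) (hpL : ‖(p : L)‖ < 1)
    (hx : pushforward (X ^ p) x = x) {a : L} (ha : ‖a‖ ≤ 1) (hxa : x.toFun (X - C a) < 1) :
    ∃ b : L, b ^ p = b ∧ evPoint b = x := by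
  set c : ℝ := max (x.toFun (X - C a)) ‖(p : L)‖ with hc
  have hc1 : c < 1 := max_lt hxa hpL
  have hc0 : 0 ≤ c := (norm_nonneg _).trans (le_max_right _ _)
  set u : ℕ → L := fun n => a ^ p ^ n with hu
  have hu_succ : ∀ n, u (n + 1) = u n ^ p := fun n => by simp only [hu, pow_succ, pow_mul]
  have hu1 : ∀ n, ‖u n‖ ≤ 1 := fun n => by
    simpa [hu] using pow_le_one₀ (norm_nonneg a) ha
  have hxu : ∀ n, x.toFun (X - C (u n)) ≤ c ^ (n + 1) := by
    intro n
    induction n with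
    | zero => simp [hu, hc]
    | succ n ih =>
      have hle : x.toFun (X - C (u n)) ≤ c := ih.trans (pow_le_of_le_one hc0 hc1.le (by simp))
      rw [← toFun_X_pow_sub_C_of_fixed hx, hu_succ, C_pow]
      refine (toFun_pow_sub_le hna x hp (by simpa [x.const'] using hu1 n)
        (hle.trans hc1.le)).trans ?_
      rw [pow_succ c (n + 1)]
      exact mul_le_mul ih (max_le hle (le_max_right _ _)) ((x.nonneg' _).trans (le_max_left _ _))
        (by positivity)
  have htri : ∀ b d : L, ‖b - d‖ ≤ x.toFun (X - C b) + x.toFun (X - C d) := by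
    intro b d
    have h := x.add_le' (C b - X) (X - C d)
    rwa [sub_add_sub_cancel, ← C_sub, x.const', x.map_sub_rev (C b)] at h
  have hcauchy : CauchySeq u := by
    refine cauchySeq_of_le_geometric c 2 hc1 fun n => ?_
    rw [dist_eq_norm]
    have h1 := hxu n
    have h2 := hxu (n + 1)
    have h3 : c ^ (n + 1) ≤ c ^ n := pow_le_pow_of_le_one hc0 hc1.le (by lia)
    have h4 : c ^ (n + 1 + 1) ≤ c ^ n := pow_le_pow_of_le_one hc0 hc1.le (by lia)
    linarith [htri (u n) (u (n + 1))]
  obtain ⟨b, hb⟩ := cauchySeq_tendsto_of_complete hcauchy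
  refine ⟨b, ?_, (eq_evPoint_of_toFun_X_sub_C_eq_zero x ?_).symm⟩
  · refine tendsto_nhds_unique (hb.pow p) ?_
    simpa only [← hu_succ, Function.comp_def] using hb.comp (tendsto_add_atTop_nat 1)
  · have hlim : Tendsto (fun n => c ^ (n + 1) + ‖u n - b‖) atTop (𝓝 0) := by
      simpa using ((tendsto_pow_atTop_nhds_zero_of_lt_one hc0 hc1).comp
        (tendsto_add_atTop_nat 1)).add (tendsto_iff_norm_sub_tendsto_zero.1 hb)
    refine le_antisymm (ge_of_tendsto' hlim fun n => ?_) (x.nonneg' _)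
    have h := x.add_le' (X - C (u n)) (C (u n - b))
    rw [C_sub, sub_add_sub_cancel, ← C_sub, x.const'] at h
    linarith [hxu n]

theorem eq_gauss_or_exists_eq_evPoint_of_fixed [CompleteSpace L] [IsAlgClosed L]
    (hna : IsNonarchimedean (fun x : L => ‖x‖)) (hp : p.Prime) (hpL : ‖(p : L)‖ < 1)
    {ζ : BerkovichPoint L} (hζ : ∀ P, ζ.toFun P = gaussNorm P)
    (hx : pushforward (X ^ p) x = x) : x = ζ ∨ ∃ b : L, b ^ p = b ∧ evPoint b = x := by
  by_cases h : ∃ a : L, ‖a‖ ≤ 1 ∧ x.toFun (X - C a) < 1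
  · obtain ⟨a, ha, hxa⟩ := h
    exact .inr (exists_eq_evPoint_of_fixed hna hp hpL hx ha hxa)
  push Not at h
  have hX : x.toFun X ≤ 1 := toFun_X_le_one_of_fixed hp.one_lt hx
  refine .inl (ext_X_sub_C fun a => ?_)
  rw [hζ, gaussNorm_X_sub_C]
  refine le_antisymm ?_ ?_
  · refine (sub_le_max hna x _ _).trans ?_
    rw [x.const']
    exact max_le_max_right _ hX
  · rcases le_or_gt ‖a‖ 1 with ha | ha
    · rw [max_eq_left ha]
      exact h a ha
    · rw [max_eq_right ha.le]
      have h' := sub_le_max hna x X (X - C a)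
      rw [sub_sub_cancel, x.const'] at h'
      exact (le_max_iff.1 h').resolve_left (hX.trans_lt ha).not_ge

end PowerMap

theorem ncard_pow_eq_self [IsAlgClosed L] [CharZero L] {p : ℕ} (hp : 1 < p) :
    {a : L | a ^ p = a}.Finite ∧ {a : L | a ^ p = a}.ncard = p := by
  obtain ⟨n, rfl⟩ : ∃ n, p = n + 1 := ⟨p - 1, by lia⟩
  have hn : 0 < n := by lia
  have : NeZero n := ⟨hn.ne'⟩
  obtain ⟨ω, hω⟩ := HasEnoughRootsOfUnity.exists_primitiveRoot L n
  have hset : {a : L | a ^ (n + 1) = a} = insert 0 (nthRootsFinset n (1 : L) : Set L) := by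
    ext a
    by_cases ha : a = 0
    · simp [ha]
    · simp [ha, mem_nthRootsFinset hn, pow_succ]
  have h0 : (0 : L) ∉ (nthRootsFinset n (1 : L) : Set L) := by
    simp [mem_nthRootsFinset hn, hn.ne']
  rw [hset]
  exact ⟨(Finset.finite_toSet _).insert _, by
    rw [Set.ncard_insert_of_notMem h0 (Finset.finite_toSet _), Set.ncard_coe_finset,
      hω.card_nthRootsFinset]⟩

end BerkovichPoint

theorem Set.Finite.connectedComponentIn_eq_singleton {Y : Type*} [TopologicalSpace Y] [T1Space Y]
    {s : Set Y} (hs : s.Finite) {y : Y} (hy : y ∈ s) : connectedComponentIn s y = {y} := by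
  have : Finite s := hs
  rw [connectedComponentIn_eq_image hy, connectedComponent_eq_singleton, Set.image_singleton]

theorem Nat.card_connectedComponents_of_totallyDisconnectedSpace (Y : Type*) [TopologicalSpace Y]
    [TotallyDisconnectedSpace Y] : Nat.card (ConnectedComponents Y) = Nat.card Y := by
  refine (Nat.card_eq_of_bijective (ConnectedComponents.mk : Y → ConnectedComponents Y)
    ⟨fun a b h => ?_, ConnectedComponents.surjective_coe⟩).symm
  rw [ConnectedComponents.coe_eq_coe, connectedComponent_eq_singleton,
    connectedComponent_eq_singleton] at h
  exact Set.singleton_injective h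

/-- Example 3.12 (sharpness of the component bound): over `L` with residue characteristic
`p`, the fixed point locus of `φ(X) = X^p` in `A¹_an` is exactly the Gauss point together
with the evaluation points at the `p + 1` classical fixed points (the roots of `X^p = X`,
with `∞` lying outside the affine line); it is finite with exactly `p + 1` elements, each
of which is its own connected component, so `Fix(φ)` has exactly `p + 1 = d + 1` connected
components. -/
theorem power_map_fixed_locus_card_components
    (L : Type*) [NontriviallyNormedField L] [CompleteSpace L] [IsAlgClosed L] [CharZero L]
    (hna : IsNonarchimedean (fun x : L => ‖x‖))
    (p : ℕ) (hp : p.Prime) (hpL : ‖(p : L)‖ < 1)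
    (ζG : BerkovichPoint L) (hζG : ∀ P : L[X], ζG.toFun P = gaussNorm P) :
    {x : BerkovichPoint L | pushforward (X ^ p) x = x} =
        insert ζG (evPoint '' {a : L | a ^ p = a}) ∧
    {x : BerkovichPoint L | pushforward (X ^ p) x = x}.Finite ∧
    {x : BerkovichPoint L | pushforward (X ^ p) x = x}.ncard = p + 1 ∧
    (∀ x ∈ {x : BerkovichPoint L | pushforward (X ^ p) x = x},
      connectedComponentIn {x : BerkovichPoint L | pushforward (X ^ p) x = x} x = {x}) ∧
    Nat.card
        (ConnectedComponents {x : BerkovichPoint L | pushforward (X ^ p) x = x}) = p + 1 := by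
  have hset : {x : BerkovichPoint L | pushforward (X ^ p) x = x} =
      insert ζG (evPoint '' {a : L | a ^ p = a}) := by
    ext x
    simp only [Set.mem_ofPred_eq, Set.mem_insert_iff, Set.mem_image]
    refine ⟨eq_gauss_or_exists_eq_evPoint_of_fixed hna hp hpL hζG, ?_⟩
    rintro (rfl | ⟨b, hb, rfl⟩)
    · refine toFun_injective (funext fun P => ?_)
      simp only [pushforward, hζG]
      rw [← expand_eq_comp_X_pow, gaussNorm_expand hp.pos]
    · rw [pushforward_evPoint, eval_pow, eval_X, hb]
  obtain ⟨hfin, hcard⟩ := ncard_pow_eq_self (L := L) hp.one_lt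
  have hfix : {x : BerkovichPoint L | pushforward (X ^ p) x = x}.Finite :=
    hset ▸ (hfin.image _).insert _
  have hncard : {x : BerkovichPoint L | pushforward (X ^ p) x = x}.ncard = p + 1 := by
    rw [hset, Set.ncard_insert_of_notMem _ (hfin.image _),
      Set.ncard_image_of_injective _ evPoint_injective, hcard]
    rintro ⟨a, -, ha⟩
    exact evPoint_ne_gauss hζG a ha
  have : Finite {x : BerkovichPoint L | pushforward (X ^ p) x = x} := hfix
  refine ⟨hset, hfix, hncard, fun x hx => hfix.connectedComponentIn_eq_singleton hx, ?_⟩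
  rw [Nat.card_connectedComponents_of_totallyDisconnectedSpace, Nat.card_coe_set_eq, hncard]
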